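/- arXiv:1102.0677 — 2 statements merged into one kernel-verified Lean document; each statement's English description precedes it below -/
import Mathlib

section
/- Let 1 < p1 < p2 ≤ 2 and set θ1 = (1/p1 − 1/p2)/(1/p1 − 1/2). Then there exists a constant c > 0, depending only on p1 and p2, such that for all N ∈ ℕ and all n ∈ ℕ with n ≤ N one has c^{-1} ξ^{θ1} ≤ c_n(id : ℓ_{p1}^N → ℓ_{p2}^N) ≤ c ξ^{θ1}, where ξ = min{1, N^{1−1/p1} n^{-1/2}}. -/
open scoped ENNReal Classical

/-- The `ℓ_p` norm on `ℂ^N`, for `p ∈ [1, ∞]` (`p = ∞` gives the sup-norm). -/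
noncomputable def lpNorm (p : ℝ≥0∞) {N : ℕ} (x : Fin N → ℂ) : ℝ :=
  if p = ∞ then ⨆ i, ‖x i‖ else (∑ i, ‖x i‖ ^ p.toReal) ^ (1 / p.toReal)

/-- The `n`-th Gelfand number of the identity map `id : ℓ_{p1}^N → ℓ_{p2}^N`:
the infimum, over all (automatically closed) linear subspaces `M` of `ℓ_{p1}^N` of
codimension `< n`, of `sup { ‖x‖_{p2} : x ∈ M, ‖x‖_{p1} ≤ 1 }`. -/
noncomputable def gelfandLp (p1 p2 : ℝ≥0∞) (N n : ℕ) : ℝ :=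
  sInf { r : ℝ | ∃ M : Submodule ℂ (Fin N → ℂ),
    Module.finrank ℂ ((Fin N → ℂ) ⧸ M) < n ∧
    r = sSup { t : ℝ | ∃ x ∈ M, lpNorm p1 x ≤ 1 ∧ t = lpNorm p2 x } }


/-! ### Rademacher averages over finite sign spaces -/

section Rademacher

open scoped BigOperators

/-- The real sign `±1` encoded by a Boolean. -/
def boolSign (b : Bool) : ℝ := if b then 1 else -1

lemma boolSign_not (b : Bool) : boolSign (!b) = -boolSign b := by
  cases b <;> simp [boolSign]

lemma boolSign_beq (a b : Bool) : boolSign (a == b) = boolSign a * boolSign b := by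
  cases a <;> cases b <;> simp [boolSign]

lemma expect_fin_succ_arrow {Ω : Type*} [Fintype Ω] {m : ℕ} (F : (Fin (m + 1) → Ω) → ℝ) :
    𝔼 ε, F ε = 𝔼 ε : Fin m → Ω, 𝔼 e : Ω, F (Fin.cons e ε) := by
  rw [← Fintype.expect_equiv (Fin.consEquiv fun _ => Ω)
    (fun z => F (Fin.cons z.1 z.2)) F (fun _ => rfl), ← Finset.univ_product_univ,
    Finset.expect_product, Finset.expect_comm]

lemma expect_bool (f : Bool → ℝ) : 𝔼 b, f b = (f true + f false) / 2 := by
  rw [Fintype.expect_eq_sum_div_card]; simp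

lemma iSup_add_abs_add_iSup_sub_abs_le {ι : Type*} [Finite ι] [Nonempty ι] (f t : ι → ℝ) :
    (⨆ b, (f b + |t b|)) + (⨆ b, (f b - |t b|)) ≤ (⨆ b, (f b + t b)) + ⨆ b, (f b - t b) := by
  have h1 := fun b => le_ciSup (Set.finite_range fun b => f b + t b).bddAbove b
  have h2 := fun b => le_ciSup (Set.finite_range fun b => f b - t b).bddAbove b
  rw [← le_sub_iff_add_le]
  refine ciSup_le fun b => ?_
  rw [le_sub_comm]
  refine ciSup_le fun b' => ?_
  have := h1 b; have := h1 b'; have := h2 b; have := h2 b'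
  rcases abs_cases (t b) with ⟨h, _⟩ | ⟨h, _⟩ <;> rcases abs_cases (t b') with ⟨h', _⟩ | ⟨h', _⟩ <;>
    rw [h, h'] <;> linarith

/-- Contraction principle for the absolute value. -/
lemma expect_iSup_abs_le {ι : Type*} [Finite ι] [Nonempty ι] {m : ℕ} (f : ι → ℝ)
    (t : Fin m → ι → ℝ) :
    𝔼 ε : Fin m → Bool, ⨆ b, (f b + ∑ i, boolSign (ε i) * |t i b|) ≤
      𝔼 ε : Fin m → Bool, ⨆ b, (f b + ∑ i, boolSign (ε i) * t i b) := by
  induction m generalizing f with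
  | zero => simp
  | succ m ih =>
    rw [expect_fin_succ_arrow, expect_fin_succ_arrow]
    calc _ ≤ 𝔼 ε : Fin m → Bool, 𝔼 e : Bool,
          ⨆ b, ((f b + boolSign e * t 0 b) + ∑ i : Fin m, boolSign (ε i) * |t i.succ b|) := by
          refine Finset.expect_le_expect fun ε _ => ?_
          rw [expect_bool, expect_bool]
          have := iSup_add_abs_add_iSup_sub_abs_le
            (fun b => f b + ∑ i : Fin m, boolSign (ε i) * |t i.succ b|) (t 0)
          simp only [Fin.sum_univ_succ, Fin.cons_zero, Fin.cons_succ, boolSign, if_true, one_mul,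
            Bool.false_eq_true, if_false, neg_one_mul] at this ⊢
          refine div_le_div_of_nonneg_right (le_of_eq_of_le ?_ (this.trans_eq ?_)) (by norm_num) <;>
          · congr 1 <;> exact congrArg _ (funext fun b => by ring)
      _ = 𝔼 e : Bool, 𝔼 ε : Fin m → Bool,
          ⨆ b, ((f b + boolSign e * t 0 b) + ∑ i : Fin m, boolSign (ε i) * |t i.succ b|) :=
          Finset.expect_comm _ _ _
      _ ≤ 𝔼 e : Bool, 𝔼 ε : Fin m → Bool,
          ⨆ b, ((f b + boolSign e * t 0 b) + ∑ i : Fin m, boolSign (ε i) * t i.succ b) :=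
          Finset.expect_le_expect fun e _ => ih _ _
      _ = _ := by
          rw [Finset.expect_comm]
          simp only [Fin.sum_univ_succ, Fin.cons_zero, Fin.cons_succ, add_assoc]

lemma expect_apply_eq {Ω : Type*} [Fintype Ω] [Nonempty Ω] {m : ℕ} (g : Ω → ℝ) (i : Fin m) :
    𝔼 A : Fin m → Ω, g (A i) = 𝔼 a, g a := by
  induction m with
  | zero => exact i.elim0
  | succ m ih =>
    rw [expect_fin_succ_arrow]
    refine Fin.cases ?_ (fun j => ?_) i
    · simp
    · simp [ih]

/-- Symmetrization. -/
lemma expect_iSup_sub_le {Ω ι : Type*} [Fintype Ω] [Nonempty Ω] [Finite ι] [Nonempty ι] {m : ℕ}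
    (g : Ω → ι → ℝ) :
    𝔼 A : Fin m → Ω, ⨆ b, ∑ i, ((𝔼 a, g a b) - g (A i) b) ≤
      2 * 𝔼 A : Fin m → Ω, 𝔼 ε : Fin m → Bool, ⨆ b, ∑ i, boolSign (ε i) * g (A i) b := by
  have bdd : ∀ f : ι → ℝ, BddAbove (Set.range f) := fun f => (Set.finite_range f).bddAbove
  let D : (Fin m → Bool) → (Fin m → Ω) × (Fin m → Ω) → ℝ := fun ε A =>
    ⨆ b, ∑ i, boolSign (ε i) * (g (A.2 i) b - g (A.1 i) b)
  have le_double : 𝔼 A : Fin m → Ω, ⨆ b, ∑ i, ((𝔼 a, g a b) - g (A i) b) ≤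
      𝔼 A, D (fun _ => true) A := by
    rw [← Finset.univ_product_univ, Finset.expect_product]
    refine Finset.expect_le_expect fun A _ => ciSup_le fun b => ?_
    have : ∑ i, ((𝔼 a, g a b) - g (A i) b) =
        𝔼 A' : Fin m → Ω, ∑ i, (g (A' i) b - g (A i) b) := by
      rw [Finset.expect_sum_comm]
      refine Finset.sum_congr rfl fun i _ => ?_
      rw [Finset.expect_sub_distrib, expect_apply_eq (fun a => g a b), Fintype.expect_const]
    rw [this]
    refine Finset.expect_le_expect fun A' _ => ?_
    have := le_ciSup (bdd fun b => ∑ i, boolSign true * (g (A' i) b - g (A i) b)) b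
    simpa [D, boolSign] using this
  have resign : ∀ ε, 𝔼 A, D ε A = 𝔼 A, D (fun _ => true) A := by
    intro ε
    let s : (Fin m → Ω) × (Fin m → Ω) → (Fin m → Ω) × (Fin m → Ω) := fun A =>
      (fun i => if ε i then A.1 i else A.2 i, fun i => if ε i then A.2 i else A.1 i)
    have hs : Function.Involutive s := by
      intro A
      refine Prod.ext (funext fun i => ?_) (funext fun i => ?_) <;> by_cases h : ε i <;> simp [s, h]
    refine Fintype.expect_equiv hs.toPerm _ _ fun A => ?_
    refine iSup_congr fun b => Finset.sum_congr rfl fun i _ => ?_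
    by_cases h : ε i <;> simp [s, h, boolSign]
  have split : ∀ ε, 𝔼 A, D ε A ≤
      (𝔼 A : Fin m → Ω, ⨆ b, ∑ i, boolSign (ε i) * g (A i) b) +
        𝔼 A : Fin m → Ω, ⨆ b, ∑ i, boolSign (!ε i) * g (A i) b := by
    intro ε
    rw [← Finset.univ_product_univ, Finset.expect_product]
    calc _ ≤ 𝔼 A : Fin m → Ω, 𝔼 A' : Fin m → Ω,
          ((⨆ b, ∑ i, boolSign (ε i) * g (A' i) b) + ⨆ b, ∑ i, boolSign (!ε i) * g (A i) b) := by
          refine Finset.expect_le_expect fun A _ => Finset.expect_le_expect fun A' _ =>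
            ciSup_le fun b => ?_
          refine le_of_eq_of_le ?_ (add_le_add
            (le_ciSup (bdd fun b => ∑ i, boolSign (ε i) * g (A' i) b) b)
            (le_ciSup (bdd fun b => ∑ i, boolSign (!ε i) * g (A i) b) b))
          rw [← Finset.sum_add_distrib]
          refine Finset.sum_congr rfl fun i _ => ?_
          rw [boolSign_not]; ring
      _ = _ := by
          simp only [Finset.expect_add_distrib, Fintype.expect_const]
  have flip : 𝔼 ε : Fin m → Bool, 𝔼 A : Fin m → Ω, ⨆ b, ∑ i, boolSign (!ε i) * g (A i) b =
      𝔼 ε : Fin m → Bool, 𝔼 A : Fin m → Ω, ⨆ b, ∑ i, boolSign (ε i) * g (A i) b := by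
    have hinv : Function.Involutive (fun (ε : Fin m → Bool) i => !ε i) := fun ε => by simp
    exact Fintype.expect_equiv hinv.toPerm _ _ fun ε => rfl
  calc _ ≤ 𝔼 A, D (fun _ => true) A := le_double
    _ = 𝔼 ε : Fin m → Bool, 𝔼 A, D ε A := by simp only [resign, Fintype.expect_const]
    _ ≤ _ := Finset.expect_le_expect fun ε _ => split ε
    _ = _ := by
      rw [Finset.expect_add_distrib, flip, ← two_mul, Finset.expect_comm]

lemma expect_sq_sum_boolSign {N : ℕ} (x : Fin N → ℝ) :
    𝔼 a : Fin N → Bool, (∑ j, boolSign (a j) * x j) ^ 2 = ∑ j, x j ^ 2 := by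
  induction N with
  | zero => simp
  | succ N ih =>
    rw [expect_fin_succ_arrow]
    have h : ∀ z : ℝ, 𝔼 e : Bool, (boolSign e * x 0 + z) ^ 2 = x 0 ^ 2 + z ^ 2 := by
      intro z; rw [expect_bool]; simp [boolSign]; ring
    simp only [Fin.sum_univ_succ, Fin.cons_zero, Fin.cons_succ, h, Finset.expect_add_distrib,
      Fintype.expect_const, ih]

lemma expect_pow_four_sum_boolSign_le {N : ℕ} (x : Fin N → ℝ) :
    𝔼 a : Fin N → Bool, (∑ j, boolSign (a j) * x j) ^ 4 ≤ 3 * (∑ j, x j ^ 2) ^ 2 := by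
  induction N with
  | zero => simp
  | succ N ih =>
    rw [expect_fin_succ_arrow]
    have h : ∀ z : ℝ, 𝔼 e : Bool, (boolSign e * x 0 + z) ^ 4 =
        x 0 ^ 4 + 6 * x 0 ^ 2 * z ^ 2 + z ^ 4 := by
      intro z; rw [expect_bool]; simp [boolSign]; ring
    simp only [Fin.sum_univ_succ, Fin.cons_zero, Fin.cons_succ, h, Finset.expect_add_distrib,
      Fintype.expect_const, ← Finset.mul_expect, expect_sq_sum_boolSign]
    nlinarith [ih fun i => x i.succ, sq_nonneg (x 0 ^ 2)]

/-- Khinchine's lower bound for the first absolute moment. -/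
lemma sqrt_le_expect_abs_sum_boolSign {N : ℕ} (x : Fin N → ℝ) :
    √(∑ j, x j ^ 2) ≤ 2 * 𝔼 a : Fin N → Bool, |∑ j, boolSign (a j) * x j| := by
  set σ := √(∑ j, x j ^ 2) with hσ
  have hσ2 : σ ^ 2 = ∑ j, x j ^ 2 := Real.sq_sqrt (Finset.sum_nonneg fun j _ => sq_nonneg _)
  rcases (Real.sqrt_nonneg (∑ j, x j ^ 2)).eq_or_lt with h0 | hpos
  · rw [hσ, ← h0]
    exact mul_nonneg (by norm_num) (Finset.expect_nonneg fun _ _ => abs_nonneg _)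
  rw [← hσ] at hpos
  have hpt : ∀ z : ℝ, σ ^ 2 * z ^ 2 - 4 / 27 * z ^ 4 ≤ σ ^ 3 * |z| := by
    intro z
    rw [← sq_abs z, show z ^ 4 = |z| ^ 4 by rw [Even.pow_abs (by decide)]]
    have hz := abs_nonneg z
    have : 0 ≤ |z| * ((2 * |z| - 3 * σ) ^ 2 * (|z| + 3 * σ)) := by positivity
    nlinarith
  have key : σ ^ 2 * (∑ j, x j ^ 2) - 4 / 27 * (3 * (∑ j, x j ^ 2) ^ 2) ≤
      σ ^ 3 * 𝔼 a : Fin N → Bool, |∑ j, boolSign (a j) * x j| := by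
    rw [Finset.mul_expect]
    refine le_trans ?_ (Finset.expect_le_expect fun a _ => hpt _)
    rw [Finset.expect_sub_distrib, ← Finset.mul_expect, ← Finset.mul_expect, expect_sq_sum_boolSign]
    linarith [expect_pow_four_sum_boolSign_le x]
  rw [← hσ2] at key
  have h3 : 0 < σ ^ 3 := by positivity
  refine le_of_mul_le_mul_left ?_ h3
  nlinarith [pow_pos hpos 4]

end Rademacher

/-! ### Kernels of random sign matrices -/

section SignMatrix

open scoped BigOperators

lemma expect_le_rpow_expect_rpow {Ω : Type*} [Fintype Ω] [Nonempty Ω] {z : Ω → ℝ}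
    (hz : ∀ a, 0 ≤ z a) {q : ℝ} (hq : 1 ≤ q) :
    𝔼 a, z a ≤ (𝔼 a, z a ^ q) ^ (1 / q) := by
  have h := Real.arith_mean_le_rpow_mean Finset.univ (fun _ : Ω => (Fintype.card Ω : ℝ)⁻¹) z
    (fun _ _ => by positivity) (by simp) (fun a _ => hz a) hq
  simpa only [Fintype.expect_eq_sum_div_card, Finset.sum_div, inv_mul_eq_div] using h

lemma expect_exp_mul_sum_boolSign_le {m N : ℕ} (j : Fin N) (l : ℝ)
    (hl : l ^ 2 * m = 1) :
    𝔼 A : Fin m → Fin N → Bool, Real.exp (l * ∑ i, boolSign (A i j)) ≤ Real.exp (1 / 2) := by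
  have hinv : Function.Involutive (fun (a : Fin N → Bool) j => !a j) := fun a => by simp
  have h1 : 𝔼 a : Fin N → Bool, Real.exp (l * boolSign (a j)) =
      𝔼 a : Fin N → Bool, Real.exp (-(l * boolSign (a j))) :=
    Fintype.expect_equiv hinv.toPerm _ _ fun a => by simp [boolSign_not]
  have h2 : 𝔼 a : Fin N → Bool, Real.exp (l * boolSign (a j)) = Real.cosh l := by
    have h3 : ∀ a : Fin N → Bool,
        Real.exp (l * boolSign (a j)) + Real.exp (-(l * boolSign (a j))) = 2 * Real.cosh l := by
      intro a
      rw [Real.cosh_eq]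
      cases a j <;> simp [boolSign] <;> ring
    have h4 : (𝔼 a : Fin N → Bool, Real.exp (l * boolSign (a j))) +
        𝔼 a : Fin N → Bool, Real.exp (-(l * boolSign (a j))) = 2 * Real.cosh l := by
      rw [← Finset.expect_add_distrib]
      simp only [h3, Fintype.expect_const]
    linarith
  have h5 := Finset.expect_pow Finset.univ
    (fun a : Fin N → Bool => Real.exp (l * boolSign (a j))) m
  rw [h2, Fintype.piFinset_univ] at h5
  simp only [← Real.exp_sum, ← Finset.mul_sum] at h5
  rw [← h5]
  calc Real.cosh l ^ m ≤ Real.exp (l ^ 2 / 2) ^ m :=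
        pow_le_pow_left₀ (Real.cosh_pos l).le (Real.cosh_le_exp_half_sq l) m
    _ = Real.exp (1 / 2) := by
        rw [← Real.exp_nat_mul]; congr 1; linarith

lemma abs_rpow_le_mul_exp_add_exp {q : ℝ} (hq : 0 ≤ q) (t : ℝ) :
    |t| ^ q ≤ (1 + (⌈q⌉₊).factorial) * (Real.exp t + Real.exp (-t)) := by
  have h1 : |t| ^ q ≤ 1 + |t| ^ ⌈q⌉₊ := by
    rcases le_total |t| 1 with h | h
    · exact (Real.rpow_le_one (abs_nonneg t) h hq).trans (by simp)
    · have := Real.rpow_le_rpow_of_exponent_le h (Nat.le_ceil q)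
      rw [Real.rpow_natCast] at this
      linarith
  have h2 := Real.pow_div_factorial_le_exp |t| (abs_nonneg t) ⌈q⌉₊
  rw [div_le_iff₀ (by positivity)] at h2
  have h3 : Real.exp |t| ≤ Real.exp t + Real.exp (-t) := by
    rcases abs_choice t with h | h <;> rw [h] <;>
      linarith [Real.exp_pos t, Real.exp_pos (-t)]
  have h4 := Real.one_le_exp (abs_nonneg t)
  have h5 : (0 : ℝ) < (⌈q⌉₊).factorial := by positivity
  nlinarith

/-- Khinchine's upper bound for the `q`-th absolute moment. -/
lemma exists_expect_abs_rpow_le {q : ℝ} (hq : 0 ≤ q) :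
    ∃ K : ℝ, 0 < K ∧ ∀ (m N : ℕ), 1 ≤ m → ∀ j : Fin N,
      𝔼 A : Fin m → Fin N → Bool, |∑ i, boolSign (A i j)| ^ q ≤ K * √m ^ q := by
  refine ⟨(1 + (⌈q⌉₊).factorial) * (2 * Real.exp (1 / 2)), by positivity, fun m N hm j => ?_⟩
  have hm' : (0 : ℝ) < m := by exact_mod_cast hm
  have hs : 0 < √(m : ℝ) := Real.sqrt_pos.2 hm'
  have hl : (1 / √(m : ℝ)) ^ 2 * m = 1 := by
    rw [div_pow, Real.sq_sqrt hm'.le]; field_simp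
  have h1 := expect_exp_mul_sum_boolSign_le j (1 / √m) hl
  have h2 := expect_exp_mul_sum_boolSign_le j (-(1 / √m)) (by rw [neg_sq]; exact hl)
  have hpt : ∀ A : Fin m → Fin N → Bool, |∑ i, boolSign (A i j)| ^ q ≤
      √m ^ q * ((1 + (⌈q⌉₊).factorial) * (Real.exp (1 / √m * ∑ i, boolSign (A i j)) +
        Real.exp (-(1 / √m) * ∑ i, boolSign (A i j)))) := by
    intro A
    have h := abs_rpow_le_mul_exp_add_exp hq (1 / √m * ∑ i, boolSign (A i j))
    rw [neg_mul]
    refine le_of_eq_of_le ?_ (mul_le_mul_of_nonneg_left h (by positivity))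
    rw [← Real.mul_rpow hs.le (abs_nonneg _), abs_mul,
      abs_of_pos (by positivity : 0 < 1 / √(m : ℝ)),
      ← mul_assoc, mul_one_div_cancel hs.ne', one_mul]
  refine (Finset.expect_le_expect fun A _ => hpt A).trans ?_
  rw [← Finset.mul_expect, ← Finset.mul_expect, Finset.expect_add_distrib, mul_comm]
  gcongr
  linarith

/-- Some sign matrix has a kernel on which the `ℓ_2` norm is controlled by the `ℓ_p` norm. -/
lemma exists_sign_matrix {p q : ℝ} (hpq : p.HolderConjugate q) :
    ∃ C : ℝ, 0 < C ∧ ∀ m N : ℕ, 1 ≤ m → ∃ A : Fin m → Fin N → Bool, ∀ x : Fin N → ℝ,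
      (∀ i, ∑ j, boolSign (A i j) * x j = 0) → ∑ j, |x j| ^ p ≤ 1 →
        √(∑ j, x j ^ 2) ≤ C * (N : ℝ) ^ (1 / q) / √m := by
  obtain ⟨K, hK, hmom⟩ := exists_expect_abs_rpow_le hpq.symm.nonneg
  refine ⟨4 * K ^ (1 / q), by positivity, fun m N hm => ?_⟩
  have hm' : (0 : ℝ) < m := by exact_mod_cast hm
  have hs : 0 < √(m : ℝ) := Real.sqrt_pos.2 hm'
  by_contra! hcon
  choose x hx0 hxp hx2 using hcon
  let S : (Fin m → Fin N → Bool) → Fin N → ℝ := fun A j => ∑ i, boolSign (A i j)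
  have lower : 2 * (K ^ (1 / q) * (N : ℝ) ^ (1 / q) * √m) <
      𝔼 A : Fin m → Fin N → Bool, ⨆ b, ∑ i,
        ((𝔼 a : Fin N → Bool, |∑ j, boolSign (a j) * x b j|) -
          |∑ j, boolSign (A i j) * x b j|) := by
    have hlt : ∀ A : Fin m → Fin N → Bool, 2 * (K ^ (1 / q) * (N : ℝ) ^ (1 / q) * √m) <
        ⨆ b, ∑ i, ((𝔼 a : Fin N → Bool, |∑ j, boolSign (a j) * x b j|) -
          |∑ j, boolSign (A i j) * x b j|) := by
      intro A
      refine lt_of_lt_of_le ?_ (le_ciSup (Set.finite_range _).bddAbove A)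
      simp only [hx0, abs_zero, sub_zero, Finset.sum_const, Finset.card_univ, Fintype.card_fin,
        nsmul_eq_mul]
      have h1 := (hx2 A).trans_le (sqrt_le_expect_abs_sum_boolSign (x A))
      have h2 := mul_lt_mul_of_pos_left h1 hm'
      have h3 : (m : ℝ) * (4 * K ^ (1 / q) * (N : ℝ) ^ (1 / q) / √m) =
          4 * (K ^ (1 / q) * (N : ℝ) ^ (1 / q) * √m) := by
        nth_rewrite 1 [← Real.mul_self_sqrt hm'.le]
        field_simp
      linarith
    exact Finset.lt_expect (fun A _ => (hlt A).le) ⟨fun _ _ => true, Finset.mem_univ _, hlt _⟩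
  have contract : 𝔼 A : Fin m → Fin N → Bool, 𝔼 ε : Fin m → Bool,
      ⨆ b, ∑ i, boolSign (ε i) * |∑ j, boolSign (A i j) * x b j| ≤
      𝔼 A, ⨆ b, ∑ j, S A j * x b j := by
    calc _ ≤ 𝔼 A : Fin m → Fin N → Bool, 𝔼 ε : Fin m → Bool,
          ⨆ b, ∑ i, boolSign (ε i) * ∑ j, boolSign (A i j) * x b j := by
          refine Finset.expect_le_expect fun A _ => ?_
          simpa using expect_iSup_abs_le (fun _ => (0 : ℝ))
            (fun i b => ∑ j, boolSign (A i j) * x b j)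
      _ = 𝔼 ε : Fin m → Bool, 𝔼 A : Fin m → Fin N → Bool, ⨆ b, ∑ j, S A j * x b j := by
          rw [Finset.expect_comm]
          refine Finset.expect_congr rfl fun ε _ => ?_
          have hinv : Function.Involutive
              (fun (A : Fin m → Fin N → Bool) i j => (ε i == A i j)) := fun A => by
            funext i j; cases ε i <;> simp
          refine Fintype.expect_equiv hinv.toPerm _ _ fun A => iSup_congr fun b => ?_
          simp only [S, Function.Involutive.coe_toPerm, boolSign_beq, Finset.mul_sum,
            Finset.sum_mul]
          rw [Finset.sum_comm]
          simp only [mul_assoc]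
      _ = _ := Fintype.expect_const _
  have holder : 𝔼 A, ⨆ b, ∑ j, S A j * x b j ≤ K ^ (1 / q) * (N : ℝ) ^ (1 / q) * √m := by
    calc _ ≤ 𝔼 A, (∑ j, |S A j| ^ q) ^ (1 / q) := by
          refine Finset.expect_le_expect fun A _ => ciSup_le fun b => ?_
          refine (Real.inner_le_Lp_mul_Lq Finset.univ (S A) (x b) hpq.symm).trans ?_
          refine mul_le_of_le_one_right (by positivity) ?_
          exact Real.rpow_le_one (by positivity) (hxp b) (one_div_nonneg.2 hpq.nonneg)
      _ ≤ (𝔼 A, ((∑ j, |S A j| ^ q) ^ (1 / q)) ^ q) ^ (1 / q) :=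
          expect_le_rpow_expect_rpow (fun A => by positivity) hpq.symm.lt.le
      _ = (∑ j, 𝔼 A, |S A j| ^ q) ^ (1 / q) := by
          rw [← Finset.expect_sum_comm]
          congr 1
          refine Finset.expect_congr rfl fun A _ => ?_
          rw [← Real.rpow_mul (by positivity), one_div_mul_cancel hpq.symm.ne_zero, Real.rpow_one]
      _ ≤ (∑ j : Fin N, K * √m ^ q) ^ (1 / q) := by
          refine Real.rpow_le_rpow
            (Finset.sum_nonneg fun j _ => Finset.expect_nonneg fun A _ => by positivity)
            (Finset.sum_le_sum fun j _ => hmom m N hm j) (one_div_nonneg.2 hpq.symm.nonneg)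
      _ = _ := by
          rw [Finset.sum_const, Finset.card_univ, Fintype.card_fin, nsmul_eq_mul,
            Real.mul_rpow (by positivity) (by positivity), Real.mul_rpow hK.le (by positivity),
            ← Real.rpow_mul hs.le, mul_one_div_cancel hpq.symm.ne_zero, Real.rpow_one]
          ring
  have sym := expect_iSup_sub_le (m := m)
    (fun (a : Fin N → Bool) b => |∑ j, boolSign (a j) * x b j|)
  linarith

end SignMatrix

/-! ### Upper bound -/

section UpperBound

lemma lpNorm_of_ne_top {p : ℝ≥0∞} (hp : p ≠ ∞) {N : ℕ} (x : Fin N → ℂ) :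
    lpNorm p x = (∑ i, ‖x i‖ ^ p.toReal) ^ (1 / p.toReal) := if_neg hp

lemma lpNorm_nonneg (p : ℝ≥0∞) {N : ℕ} (x : Fin N → ℂ) : 0 ≤ lpNorm p x := by
  unfold lpNorm
  split_ifs
  · exact Real.iSup_nonneg fun i => norm_nonneg _
  · positivity

lemma sum_rpow_le_one_of_lpNorm_le_one {p : ℝ≥0∞} (hp : p ≠ ∞) (hp0 : 0 < p.toReal) {N : ℕ}
    {x : Fin N → ℂ} (hx : lpNorm p x ≤ 1) : ∑ i, ‖x i‖ ^ p.toReal ≤ 1 := by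
  rw [lpNorm_of_ne_top hp] at hx
  by_contra! h
  exact hx.not_gt (Real.one_lt_rpow h (by positivity))

/-- Interpolation between `ℓ_a` and `ℓ_2`. -/
lemma sum_rpow_le_rpow_sum_sq {N : ℕ} {z : Fin N → ℝ} (hz : ∀ i, 0 ≤ z i) {a b : ℝ} (ha : 0 < a)
    (hab : a < b) (hb : b ≤ 2) (h1 : ∑ i, z i ^ a ≤ 1) :
    ∑ i, z i ^ b ≤ (∑ i, z i ^ 2) ^ ((b - a) / (2 - a)) := by
  rcases hb.eq_or_lt with rfl | hb
  · rw [div_self (by linarith)]; simp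
  have h2a : 0 < 2 - a := by linarith
  set s := (b - a) / (2 - a) with hs
  have hs0 : 0 < s := div_pos (by linarith) h2a
  have hs1 : s < 1 := (div_lt_one h2a).2 (by linarith)
  have hsb : a * (1 - s) + 2 * s = b := by rw [hs]; field_simp; ring
  have hpq : (1 / (1 - s)).HolderConjugate (1 / s) := by
    rw [Real.holderConjugate_iff]
    refine ⟨(one_lt_div (by linarith)).2 (by linarith), by simp⟩
  have h := Real.inner_le_Lp_mul_Lq_of_nonneg Finset.univ (f := fun i => z i ^ (a * (1 - s)))
    (g := fun i => z i ^ (2 * s)) hpq (fun i _ => Real.rpow_nonneg (hz i) _)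
    (fun i _ => Real.rpow_nonneg (hz i) _)
  have e1 : ∀ i, (z i ^ (a * (1 - s))) ^ (1 / (1 - s)) = z i ^ a := fun i => by
    rw [← Real.rpow_mul (hz i)]; congr 1; field_simp [(by linarith : 1 - s ≠ 0)]
  have e2 : ∀ i, (z i ^ (2 * s)) ^ (1 / s) = z i ^ 2 := fun i => by
    rw [← Real.rpow_mul (hz i), ← Real.rpow_two]; congr 1; field_simp
  have e3 : ∀ i, z i ^ (a * (1 - s)) * z i ^ (2 * s) = z i ^ b := fun i => by
    rw [← Real.rpow_add_of_nonneg (hz i) (mul_nonneg ha.le (by linarith)) (by positivity), hsb]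
  simp only [e1, e2, e3, one_div_one_div] at h
  refine h.trans (mul_le_of_le_one_left ?_ (Real.rpow_le_one ?_ h1 (by linarith)))
  · exact Real.rpow_nonneg (Finset.sum_nonneg fun i _ => sq_nonneg _) _
  · exact Finset.sum_nonneg fun i _ => Real.rpow_nonneg (hz i) _

lemma lpNorm_le_one_of_lpNorm_le_one {p1 p2 : ℝ≥0∞} (hp1 : 1 < p1) (hp12 : p1 < p2) (hp2 : p2 ≤ 2)
    {N : ℕ} {x : Fin N → ℂ} (hx : lpNorm p1 x ≤ 1) : lpNorm p2 x ≤ 1 := by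
  have ht2 : p2 ≠ ∞ := (hp2.trans_lt (by simp)).ne
  have ht1 : p1 ≠ ∞ := (hp12.trans_le le_top).ne
  have h0 : 0 < p1.toReal := ENNReal.toReal_pos (by positivity) ht1
  have h12 : p1.toReal < p2.toReal := (ENNReal.toReal_lt_toReal ht1 ht2).2 hp12
  have hs := sum_rpow_le_one_of_lpNorm_le_one ht1 h0 hx
  rw [lpNorm_of_ne_top ht2]
  refine Real.rpow_le_one (by positivity) (le_trans (Finset.sum_le_sum fun i _ => ?_) hs)
    (by positivity)
  have hi : ‖x i‖ ^ p1.toReal ≤ 1 := (Finset.single_le_sum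
    (f := fun i => ‖x i‖ ^ p1.toReal) (fun i _ => by positivity) (Finset.mem_univ i)).trans hs
  have hi1 : ‖x i‖ ≤ 1 := by
    by_contra! h
    exact hi.not_gt (Real.one_lt_rpow h h0)
  rcases (norm_nonneg (x i)).eq_or_lt with h | h
  · rw [← h, Real.zero_rpow h0.ne', Real.zero_rpow (h0.trans h12).ne']
  · exact Real.rpow_le_rpow_of_exponent_ge h hi1 h12.le

lemma gelfandLp_le {p1 p2 : ℝ≥0∞} {N n : ℕ} (M : Submodule ℂ (Fin N → ℂ))
    (hM : Module.finrank ℂ ((Fin N → ℂ) ⧸ M) < n) {r : ℝ} (hr : 0 ≤ r)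
    (h : ∀ x ∈ M, lpNorm p1 x ≤ 1 → lpNorm p2 x ≤ r) : gelfandLp p1 p2 N n ≤ r := by
  refine csInf_le_of_le ⟨0, ?_⟩ ⟨M, hM, rfl⟩ (Real.sSup_le ?_ hr)
  · rintro _ ⟨M, -, rfl⟩
    refine Real.sSup_nonneg ?_
    rintro _ ⟨x, -, -, rfl⟩
    exact lpNorm_nonneg _ _
  · rintro _ ⟨x, hx, hx1, rfl⟩
    exact h x hx hx1

/-- The subspace of vectors annihilated by a matrix of signs. -/
def signKer {m N : ℕ} (A : Fin m → Fin N → Bool) : Submodule ℂ (Fin N → ℂ) :=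
  LinearMap.ker (Matrix.mulVecLin (Matrix.of fun i j => (boolSign (A i j) : ℂ)))

lemma finrank_quotient_signKer_le {m N : ℕ} (A : Fin m → Fin N → Bool) :
    Module.finrank ℂ ((Fin N → ℂ) ⧸ signKer A) ≤ m := by
  unfold signKer
  rw [LinearEquiv.finrank_eq (LinearMap.quotKerEquivRange _)]
  exact (Submodule.finrank_le _).trans (by simp)

lemma sum_re_im_eq_zero_of_mem_signKer {m N : ℕ} {A : Fin m → Fin N → Bool} {x : Fin N → ℂ}
    (hx : x ∈ signKer A) (i : Fin m) :
    ∑ j, boolSign (A i j) * (x j).re = 0 ∧ ∑ j, boolSign (A i j) * (x j).im = 0 := by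
  have h : ∑ j, (boolSign (A i j) : ℂ) * x j = 0 := congrFun (LinearMap.mem_ker.1 hx) i
  constructor
  · simpa using congrArg Complex.re h
  · simpa using congrArg Complex.im h

lemma sum_sq_norm_le_of_mem_signKer {m N : ℕ} {A : Fin m → Fin N → Bool} {p R : ℝ} (hp : 0 ≤ p)
    (hA : ∀ x : Fin N → ℝ, (∀ i, ∑ j, boolSign (A i j) * x j = 0) → ∑ j, |x j| ^ p ≤ 1 →
      √(∑ j, x j ^ 2) ≤ R)
    {x : Fin N → ℂ} (hx : x ∈ signKer A) (hx1 : ∑ j, ‖x j‖ ^ p ≤ 1) :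
    ∑ j, ‖x j‖ ^ 2 ≤ 2 * R ^ 2 := by
  have hre := hA (fun j => (x j).re) (fun i => (sum_re_im_eq_zero_of_mem_signKer hx i).1)
    ((Finset.sum_le_sum fun j _ =>
      Real.rpow_le_rpow (abs_nonneg _) (Complex.abs_re_le_norm (x j)) hp).trans hx1)
  have him := hA (fun j => (x j).im) (fun i => (sum_re_im_eq_zero_of_mem_signKer hx i).2)
    ((Finset.sum_le_sum fun j _ =>
      Real.rpow_le_rpow (abs_nonneg _) (Complex.abs_im_le_norm (x j)) hp).trans hx1)
  have hre' := (Real.sqrt_le_left ((Real.sqrt_nonneg _).trans hre)).1 hre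
  have him' := (Real.sqrt_le_left ((Real.sqrt_nonneg _).trans him)).1 him
  have : ∑ j, ‖x j‖ ^ 2 = ∑ j, (x j).re ^ 2 + ∑ j, (x j).im ^ 2 := by
    rw [← Finset.sum_add_distrib]
    refine Finset.sum_congr rfl fun j _ => ?_
    rw [Complex.sq_norm, Complex.normSq_apply]; ring
  linarith

theorem exists_gelfandLp_le {p1 p2 : ℝ≥0∞} (hp1 : 1 < p1) (hp12 : p1 < p2) (hp2 : p2 ≤ 2) :
    ∃ c : ℝ, 0 < c ∧ ∀ N n : ℕ, 1 ≤ n → n ≤ N → gelfandLp p1 p2 N n ≤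
      c * min 1 ((N : ℝ) ^ (1 - 1 / p1.toReal) * (n : ℝ) ^ (-(1 : ℝ) / 2)) ^
          ((1 / p1.toReal - 1 / p2.toReal) / (1 / p1.toReal - 1 / 2)) := by
  have ht2 : p2 ≠ ∞ := (hp2.trans_lt (by simp)).ne
  have ht1 : p1 ≠ ∞ := (hp12.trans_le le_top).ne
  have h1 : 1 < p1.toReal := by
    simpa using (ENNReal.toReal_lt_toReal (by simp) ht1).2 hp1
  have h12 : p1.toReal < p2.toReal := (ENNReal.toReal_lt_toReal ht1 ht2).2 hp12
  have h2 : p2.toReal ≤ 2 := by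
    simpa using (ENNReal.toReal_le_toReal ht2 (by simp)).2 hp2
  set a := p1.toReal with ha
  set b := p2.toReal with hb
  have ha0 : 0 < a := by linarith
  have hb0 : 0 < b := by linarith
  have h2a : 0 < 2 - a := by linarith
  have hθ : (1 / a - 1 / b) / (1 / a - 1 / 2) = 2 * ((b - a) / (2 - a)) / b := by
    field_simp
  set θ := (1 / a - 1 / b) / (1 / a - 1 / 2) with hθdef
  have hθ0 : 0 ≤ θ := by
    rw [hθ]; exact div_nonneg (mul_nonneg (by norm_num) (div_nonneg (by linarith) h2a.le)) hb0.le
  have hpq : a.HolderConjugate (Real.conjExponent a) := Real.HolderConjugate.conjExponent h1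
  have hq : 1 / Real.conjExponent a = 1 - 1 / a := by
    have := hpq.inv_add_inv_eq_one
    rw [one_div, one_div]; linarith
  obtain ⟨C, hC, hmat⟩ := exists_sign_matrix hpq
  rw [hq] at hmat
  refine ⟨1 + (2 * C) ^ θ, by positivity, fun N n hn hnN => ?_⟩
  set ξ := (N : ℝ) ^ (1 - 1 / a) * (n : ℝ) ^ (-(1 : ℝ) / 2) with hξ
  have hn0 : (0 : ℝ) < n := by exact_mod_cast hn
  have hN1 : (1 : ℝ) ≤ N := by exact_mod_cast hn.trans hnN
  have hNpow : 1 ≤ (N : ℝ) ^ (1 - 1 / a) :=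
    Real.one_le_rpow hN1 (by rw [sub_nonneg, div_le_one ha0]; exact h1.le)
  rcases le_or_gt 1 ξ with hξ1 | hξ1
  · rw [min_eq_left hξ1, Real.one_rpow, mul_one]
    have hC' : 0 ≤ (2 * C) ^ θ := by positivity
    refine gelfandLp_le ⊤ ?_ (by linarith) fun x _ hx =>
      (lpNorm_le_one_of_lpNorm_le_one hp1 hp12 hp2 hx).trans (by linarith)
    rw [Module.finrank_zero_of_subsingleton]; exact hn
  rw [min_eq_right hξ1.le]
  have hn2 : 2 ≤ n := by
    by_contra! h
    obtain rfl : n = 1 := by omega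
    rw [hξ, Nat.cast_one, Real.one_rpow, mul_one] at hξ1
    linarith
  obtain ⟨A, hA⟩ := hmat (n - 1) N (by omega)
  have hξ0 : 0 < ξ := by positivity
  have hm : (n : ℝ) ≤ 2 * ((n - 1 : ℕ) : ℝ) := by
    exact_mod_cast (by omega : n ≤ 2 * (n - 1))
  have hR : 2 * (C * (N : ℝ) ^ (1 - 1 / a) / √((n - 1 : ℕ) : ℝ)) ^ 2 ≤ (2 * C * ξ) ^ 2 := by
    have e : ((n : ℝ) ^ (-(1 : ℝ) / 2)) ^ 2 = (n : ℝ)⁻¹ := by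
      rw [← Real.rpow_natCast, ← Real.rpow_mul hn0.le, ← Real.rpow_neg_one]; norm_num
    rw [div_pow, Real.sq_sqrt (by positivity), hξ]
    simp only [mul_pow, e]
    have hm0 : (0 : ℝ) < ((n - 1 : ℕ) : ℝ) := by linarith
    rw [mul_div_assoc', div_le_iff₀ hm0]
    have e2 : 1 ≤ 2 * ((n : ℝ)⁻¹ * ((n - 1 : ℕ) : ℝ)) := by
      rw [inv_mul_eq_div, mul_div_assoc', le_div_iff₀ hn0]; linarith
    have e3 : 0 ≤ 2 * (C ^ 2 * ((N : ℝ) ^ (1 - 1 / a)) ^ 2) := by positivity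
    nlinarith [mul_le_mul_of_nonneg_left e2 e3]
  refine gelfandLp_le (signKer A) ((finrank_quotient_signKer_le A).trans_lt (by omega))
    (by positivity) fun x hx hx1 => ?_
  have hs := sum_rpow_le_one_of_lpNorm_le_one ht1 ha0 hx1
  have hsq := (sum_sq_norm_le_of_mem_signKer ha0.le hA hx hs).trans hR
  have hinterp := sum_rpow_le_rpow_sum_sq (fun i => norm_nonneg (x i)) ha0 h12 h2 hs
  rw [lpNorm_of_ne_top ht2]
  calc (∑ i, ‖x i‖ ^ b) ^ (1 / b) ≤ ((((2 * C * ξ) ^ 2) ^ ((b - a) / (2 - a)))) ^ (1 / b) := by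
        refine Real.rpow_le_rpow (by positivity) (hinterp.trans ?_) (by positivity)
        exact Real.rpow_le_rpow (by positivity) hsq (div_nonneg (by linarith) h2a.le)
    _ = (2 * C) ^ θ * ξ ^ θ := by
        rw [← Real.mul_rpow (by positivity) hξ0.le, ← Real.rpow_natCast,
          ← Real.rpow_mul (by positivity),
          ← Real.rpow_mul (by positivity), hθ]
        congr 1; push_cast; ring
    _ ≤ (1 + (2 * C) ^ θ) * ξ ^ θ := by
        gcongr; linarith

end UpperBound

/-! ### Lower bound -/

section LowerBound

lemma exists_card_eq_sum_le {N : ℕ} (f : Fin N → ℝ) {α : ℝ} (h : ∑ i, f i ≤ N * α) {k : ℕ}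
    (hk : k ≤ N) : ∃ S : Finset (Fin N), S.card = k ∧ ∑ i ∈ S, f i ≤ k * α := by
  induction hk using Nat.decreasingInduction with
  | self => exact ⟨Finset.univ, by simp, h⟩
  | of_succ k hk ih =>
    obtain ⟨S, hS, hSf⟩ := ih
    have hne : S.Nonempty := Finset.card_pos.1 (by omega)
    obtain ⟨i, hi, hmax⟩ := S.exists_max_image f hne
    refine ⟨S.erase i, by rw [Finset.card_erase_of_mem hi, hS]; rfl, ?_⟩
    have h1 : ∑ j ∈ S, f j ≤ (k + 1 : ℝ) * f i := by
      simpa [hS] using Finset.sum_le_card_nsmul S f (f i) hmax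
    rw [← Finset.add_sum_erase S f hi] at h1 hSf
    push_cast at hSf
    by_contra! hcon
    have h2 : f i < α := by nlinarith
    have h3 : (k : ℝ) * f i ≤ k * α := by gcongr
    linarith

lemma exists_sign_norm_sum_sq_le {V ι : Type*} [NormedAddCommGroup V] [InnerProductSpace ℂ V]
    (v : ι → V) (S : Finset ι) : ∃ ε : ι → ℂ, (∀ i, ‖ε i‖ = 1) ∧
      ‖∑ i ∈ S, ε i • v i‖ ^ 2 ≤ ∑ i ∈ S, ‖v i‖ ^ 2 := by
  induction S using Finset.induction_on with
  | empty => exact ⟨fun _ => 1, by simp, by simp⟩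
  | insert a S ha ih =>
    obtain ⟨ε, hε, hS⟩ := ih
    have hsum : ∀ c : ℂ, ∑ i ∈ insert a S, Function.update ε a c i • v i =
        (∑ i ∈ S, ε i • v i) + c • v a := by
      intro c
      rw [Finset.sum_insert ha, Function.update_self, add_comm]
      congr 1
      refine Finset.sum_congr rfl fun i hi => ?_
      rw [Function.update_of_ne (by rintro rfl; exact ha hi)]
    have hupd : ∀ c : ℂ, ‖c‖ = 1 → ∀ i, ‖Function.update ε a c i‖ = 1 := by
      intro c hc i
      by_cases h : i = a
      · subst h; simpa using hc
      · rw [Function.update_of_ne h, hε]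
    have hpar := parallelogram_law_with_norm ℂ (∑ i ∈ S, ε i • v i) (v a)
    rw [Finset.sum_insert ha]
    by_cases hc : ‖(∑ i ∈ S, ε i • v i) + v a‖ ^ 2 ≤ ‖v a‖ ^ 2 + ∑ i ∈ S, ‖v i‖ ^ 2
    · exact ⟨Function.update ε a 1, hupd 1 (by simp), by rw [hsum, one_smul]; exact hc⟩
    · refine ⟨Function.update ε a (-1), hupd (-1) (by simp), ?_⟩
      rw [hsum, neg_one_smul, ← sub_eq_add_neg]
      nlinarith

lemma sum_norm_sq_starProjection {E ι : Type*} [NormedAddCommGroup E] [InnerProductSpace ℂ E]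
    [FiniteDimensional ℂ E] [Fintype ι] (e : OrthonormalBasis ι ℂ E) (U : Submodule ℂ E) :
    ∑ i, ‖U.starProjection (e i)‖ ^ 2 = Module.finrank ℂ U := by
  let u := stdOrthonormalBasis ℂ U
  have h : ∀ i, ‖U.starProjection (e i)‖ ^ 2 = ∑ k, ‖inner ℂ (u k : E) (e i)‖ ^ 2 := by
    intro i
    have := u.sum_sq_norm_inner_right (U.orthogonalProjectionOnto (e i))
    rw [Submodule.starProjection_apply, ← Submodule.coe_norm, ← this]
    refine Finset.sum_congr rfl fun k _ => ?_
    rw [Submodule.inner_orthogonalProjectionOnto_eq_of_mem_left]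
  simp only [h]
  rw [Finset.sum_comm]
  have h2 : ∀ k, ∑ i, ‖inner ℂ (u k : E) (e i)‖ ^ 2 = 1 := by
    intro k
    rw [e.sum_sq_norm_inner_left, ← Submodule.coe_norm, u.norm_eq_one, one_pow]
  simp [h2]

/-- A subspace of small codimension contains small perturbations of flat `k`-sparse vectors. -/
lemma exists_mem_near_sparse {N : ℕ} (M : Submodule ℂ (Fin N → ℂ)) {k : ℕ} (hk : k ≤ N)
    (hN : 0 < N) : ∃ S : Finset (Fin N), S.card = k ∧ ∃ x ∈ M, ∃ z : Fin N → ℂ,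
      (∀ i, ‖x i‖ ≤ (if i ∈ S then 1 else 0) + ‖z i‖) ∧
      ∑ i, ‖z i‖ ^ 2 ≤ k * ((Module.finrank ℂ ((Fin N → ℂ) ⧸ M) : ℝ) / N) ∧
      k - k * ((Module.finrank ℂ ((Fin N → ℂ) ⧸ M) : ℝ) / N) ≤ ∑ i ∈ S, ‖x i‖ := by
  set m := Module.finrank ℂ ((Fin N → ℂ) ⧸ M) with hm
  let φ := WithLp.linearEquiv 2 ℂ (Fin N → ℂ)
  let M' : Submodule ℂ (EuclideanSpace ℂ (Fin N)) := M.comap φ.toLinearMap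
  have hMM : Module.finrank ℂ M' = Module.finrank ℂ M :=
    LinearEquiv.finrank_eq (φ.ofSubmodule' M)
  have hL : Module.finrank ℂ M'ᗮ = m := by
    have h1 := M'.finrank_add_finrank_orthogonal
    have h2 := M.finrank_quotient_add_finrank
    rw [finrank_euclideanSpace_fin] at h1
    rw [Module.finrank_fin_fun] at h2
    omega
  let e := EuclideanSpace.basisFun (Fin N) ℂ
  have htr := sum_norm_sq_starProjection e M'ᗮ
  rw [hL] at htr
  have hN' : (0 : ℝ) < N := by exact_mod_cast hN
  obtain ⟨S, hS, hSsum⟩ := exists_card_eq_sum_le (fun i => ‖M'ᗮ.starProjection (e i)‖ ^ 2)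
    (α := m / N) (by rw [htr]; field_simp; rfl) hk
  obtain ⟨ε, hε, hεsum⟩ := exists_sign_norm_sum_sq_le (fun i => M'ᗮ.starProjection (e i)) S
  let y : EuclideanSpace ℂ (Fin N) := ∑ i ∈ S, ε i • e i
  have hy : ∀ i, y i = if i ∈ S then ε i else 0 := by
    intro i
    simp [y, e, Pi.single_apply]
  let z := M'ᗮ.starProjection y
  let x := M'.starProjection y
  have hz : z = ∑ i ∈ S, ε i • M'ᗮ.starProjection (e i) := by
    simp [z, y, map_sum]
  have hzn : ‖z‖ ^ 2 ≤ k * ((m : ℝ) / N) := by rw [hz]; exact hεsum.trans hSsum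
  have hxz : x + z = y := M'.starProjection_add_starProjection_orthogonal y
  have hyn : ‖y‖ ^ 2 = k := by
    rw [EuclideanSpace.norm_sq_eq, ← hS]
    simp only [hy]
    have h : ∀ i, ‖if i ∈ S then ε i else 0‖ ^ 2 = if i ∈ S then (1 : ℝ) else 0 := by
      intro i; split_ifs <;> simp [hε]
    simp [h]
  have hpyth : ‖y‖ ^ 2 = ‖x‖ ^ 2 + ‖z‖ ^ 2 :=
    Submodule.norm_sq_eq_add_norm_sq_starProjection y M'
  refine ⟨S, hS, φ x, (M'.starProjection_apply_mem y : x ∈ M'), φ z, fun i => ?_, ?_, ?_⟩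
  · have h1 : x i = y i - z i := by rw [← hxz]; simp
    change ‖x i‖ ≤ _ + ‖z i‖
    rw [h1, hy]
    refine (norm_sub_le _ _).trans (add_le_add_left ?_ _)
    split_ifs
    · exact (hε i).le
    · simp
  · rw [EuclideanSpace.norm_sq_eq] at hzn
    exact hzn
  · have hinner : inner ℂ y x = (‖x‖ : ℂ) ^ 2 := by
      have hx : M'.starProjection x = x :=
        Submodule.starProjection_eq_self_iff.2 (M'.starProjection_apply_mem y)
      have h : inner ℂ x x = inner ℂ y (M'.starProjection x) :=
        M'.inner_starProjection_left_eq_right y x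
      rw [hx] at h
      exact h.symm.trans (inner_self_eq_norm_sq_to_K (𝕜 := ℂ) x)
    have hsum : inner ℂ y x = ∑ i ∈ S, star (ε i) * x i := by
      simp [y, e, EuclideanSpace.inner_single_left, mul_comm]
    have hle : ‖x‖ ^ 2 ≤ ∑ i ∈ S, ‖x i‖ := by
      have h := norm_sum_le S fun i => star (ε i) * x i
      rw [← hsum, hinner] at h
      simpa [hε] using h
    change _ ≤ ∑ i ∈ S, ‖x i‖
    linarith

lemma rpow_sum_le_card_rpow_mul {ι : Type*} (s : Finset ι) {z : ι → ℝ} (hz : ∀ i, 0 ≤ z i)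
    {a b : ℝ} (ha : 0 < a) (hab : a ≤ b) :
    (∑ i ∈ s, z i ^ a) ^ (1 / a) ≤
      (s.card : ℝ) ^ (1 / a - 1 / b) * (∑ i ∈ s, z i ^ b) ^ (1 / b) := by
  have hb : 0 < b := ha.trans_le hab
  have hnn : ∀ c : ℝ, 0 ≤ ∑ i ∈ s, z i ^ c := fun c =>
    Finset.sum_nonneg fun i _ => Real.rpow_nonneg (hz i) _
  have h := Real.rpow_sum_le_const_mul_sum_rpow_of_nonneg s (f := fun i => z i ^ a)
    ((one_le_div ha).2 hab) (fun i _ => Real.rpow_nonneg (hz i) _)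
  have e : ∀ i, (z i ^ a) ^ (b / a) = z i ^ b := fun i => by
    rw [← Real.rpow_mul (hz i)]; congr 1; field_simp
  simp only [e] at h
  have h2 := Real.rpow_le_rpow (Real.rpow_nonneg (hnn a) _) h (one_div_nonneg.2 hb.le)
  rw [← Real.rpow_mul (hnn a), Real.mul_rpow (by positivity) (hnn b),
    ← Real.rpow_mul (by positivity)] at h2
  convert h2 using 3 <;> field_simp

lemma lpNorm_smul {p : ℝ≥0∞} (hp : p ≠ ∞) (hp0 : 0 < p.toReal) {N : ℕ} {c : ℝ} (hc : 0 ≤ c)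
    (x : Fin N → ℂ) : lpNorm p ((c : ℂ) • x) = c * lpNorm p x := by
  rw [lpNorm_of_ne_top hp, lpNorm_of_ne_top hp]
  have h : ∀ i, ‖((c : ℂ) • x) i‖ ^ p.toReal = c ^ p.toReal * ‖x i‖ ^ p.toReal := fun i => by
    rw [Pi.smul_apply, norm_smul, Complex.norm_real, Real.norm_of_nonneg hc,
      Real.mul_rpow hc (norm_nonneg _)]
  simp only [h]
  rw [← Finset.mul_sum, Real.mul_rpow (by positivity) (by positivity), ← Real.rpow_mul hc,
    mul_one_div_cancel hp0.ne', Real.rpow_one]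

lemma le_gelfandLp {p1 p2 : ℝ≥0∞} (hp1 : 1 < p1) (hp12 : p1 < p2) (hp2 : p2 ≤ 2) {N n : ℕ}
    (hn : 1 ≤ n) {r : ℝ}
    (h : ∀ M : Submodule ℂ (Fin N → ℂ), Module.finrank ℂ ((Fin N → ℂ) ⧸ M) < n →
      ∃ x ∈ M, ∃ D : ℝ, 0 < D ∧ lpNorm p1 x ≤ D ∧ r * D ≤ lpNorm p2 x) :
    r ≤ gelfandLp p1 p2 N n := by
  have ht2 : p2 ≠ ∞ := (hp2.trans_lt (by simp)).ne
  have ht1 : p1 ≠ ∞ := (hp12.trans_le le_top).ne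
  have h1 : 0 < p1.toReal := ENNReal.toReal_pos (by positivity) ht1
  have h2 : 0 < p2.toReal := h1.trans ((ENNReal.toReal_lt_toReal ht1 ht2).2 hp12)
  refine le_csInf ⟨_, ⊤, ?_, rfl⟩ ?_
  · rw [Module.finrank_zero_of_subsingleton]; exact hn
  rintro _ ⟨M, hM, rfl⟩
  obtain ⟨x, hx, D, hD, hxD, hrD⟩ := h M hM
  refine le_csSup_of_le ⟨1, ?_⟩ ⟨((D⁻¹ : ℝ) : ℂ) • x, M.smul_mem _ hx, ?_, rfl⟩ ?_
  · rintro _ ⟨x, -, hx, rfl⟩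
    exact lpNorm_le_one_of_lpNorm_le_one hp1 hp12 hp2 hx
  · rw [lpNorm_smul ht1 h1 (by positivity), inv_mul_le_iff₀ hD, mul_one]
    exact hxD
  · rw [lpNorm_smul ht2 h2 (by positivity), le_inv_mul_iff₀ hD, mul_comm]
    exact hrD


set_option maxHeartbeats 1000000 in
theorem min_rpow_le_gelfandLp {p1 p2 : ℝ≥0∞} (hp1 : 1 < p1) (hp12 : p1 < p2) (hp2 : p2 ≤ 2)
    {N n : ℕ} (hn : 1 ≤ n) (hnN : n ≤ N) :
    1 / 8 * min 1 ((N : ℝ) ^ (1 - 1 / p1.toReal) * (n : ℝ) ^ (-(1 : ℝ) / 2)) ^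
          ((1 / p1.toReal - 1 / p2.toReal) / (1 / p1.toReal - 1 / 2)) ≤ gelfandLp p1 p2 N n := by
  have ht2 : p2 ≠ ∞ := (hp2.trans_lt (by simp)).ne
  have ht1 : p1 ≠ ∞ := (hp12.trans_le le_top).ne
  have h1 : 1 < p1.toReal := by
    simpa using (ENNReal.toReal_lt_toReal (by simp) ht1).2 hp1
  have h12 : p1.toReal < p2.toReal := (ENNReal.toReal_lt_toReal ht1 ht2).2 hp12
  have h2 : p2.toReal ≤ 2 := by
    simpa using (ENNReal.toReal_le_toReal ht2 (by simp)).2 hp2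
  refine le_gelfandLp hp1 hp12 hp2 hn fun M hM => ?_
  simp only [lpNorm_of_ne_top ht1, lpNorm_of_ne_top ht2]
  set a := p1.toReal with ha
  set b := p2.toReal with hb
  have ha0 : 0 < a := by linarith
  have hb0 : 0 < b := by linarith
  set w := 1 / a - 1 / 2 with hw
  set δ := 1 / a - 1 / b with hδ
  have hw0 : 0 < w := sub_pos.2 (one_div_lt_one_div_of_lt ha0 (by linarith))
  have hδ0 : 0 < δ := sub_pos.2 (one_div_lt_one_div_of_lt ha0 h12)
  have hδw : δ ≤ w := sub_le_sub_left (one_div_le_one_div_of_le hb0 h2) _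
  have ha1 : 1 / a < 1 := (div_lt_one ha0).2 h1
  have hδ1 : δ ≤ 1 := by linarith
  have hn0 : (0 : ℝ) < n := by exact_mod_cast hn
  have hnN' : (n : ℝ) ≤ N := by exact_mod_cast hnN
  have hN0 : (0 : ℝ) < N := hn0.trans_le hnN'
  have hN1 : (1 : ℝ) ≤ N := by exact_mod_cast hn.trans hnN
  set ξ₀ := (N : ℝ) ^ (1 - 1 / a) * (n : ℝ) ^ (-(1 : ℝ) / 2) with hξ₀
  have hξ₀0 : 0 < ξ₀ := by positivity
  set ξ := min 1 ξ₀ with hξ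
  have hξ0 : 0 < ξ := lt_min one_pos hξ₀0
  set m := Module.finrank ℂ ((Fin N → ℂ) ⧸ M) with hm
  have hmn : (m : ℝ) ≤ n := by exact_mod_cast hM.le
  have hNw : (N : ℝ) ^ (1 - 1 / a) * (N : ℝ) ^ (-(1 : ℝ) / 2) = (N : ℝ) ^ (-w) := by
    rw [← Real.rpow_add hN0]; congr 1; rw [hw]; ring
  rcases le_or_gt (2 * m) N with hmN | hmN
  · -- The codimension is at most half of the dimension.
    have hξN : (N : ℝ) ^ (-w) ≤ ξ := by
      refine le_min (Real.rpow_le_one_of_one_le_of_nonpos hN1 (by linarith)) ?_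
      rw [← hNw, hξ₀]
      exact mul_le_mul_of_nonneg_left
        (Real.rpow_le_rpow_of_nonpos hn0 hnN' (by norm_num)) (by positivity)
    set κ := ξ ^ (-(1 / w)) with hκ
    have hκ1 : 1 ≤ κ := Real.one_le_rpow_of_pos_of_le_one_of_nonpos hξ0 (min_le_left _ _)
      (by simpa using hw0.le)
    have hκw : κ ^ w = ξ⁻¹ := by
      rw [hκ, ← Real.rpow_mul hξ0.le, ← Real.rpow_neg_one]; congr 1; field_simp
    have hκδ : κ ^ δ * ξ ^ (δ / w) = 1 := by
      have e : -(1 / w) * δ + δ / w = 0 := by ring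
      rw [hκ, ← Real.rpow_mul hξ0.le, ← Real.rpow_add hξ0, e, Real.rpow_zero]
    have hκN : κ ≤ N := by
      have h := Real.rpow_le_rpow_of_nonpos (by positivity) hξN
        (show -(1 / w) ≤ 0 by simpa using hw0.le)
      rw [← Real.rpow_mul hN0.le] at h
      have e : -w * -(1 / w) = 1 := by field_simp
      rwa [e, Real.rpow_one] at h
    set k := ⌈κ⌉₊ with hk
    have hκk : κ ≤ k := Nat.le_ceil κ
    have hkκ : (k : ℝ) ≤ 2 * κ := by
      have := Nat.ceil_lt_add_one (zero_le_one.trans hκ1)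
      linarith
    have hk0 : (0 : ℝ) < k := by linarith
    obtain ⟨S, hS, x, hxM, z, hxz, hz, hxS⟩ :=
      exists_mem_near_sparse M (Nat.ceil_le.2 hκN) (by omega)
    rw [← hm] at hz hxS
    rw [← hk] at hS hz hxS
    refine ⟨x, hxM, 2 * (k : ℝ) ^ (1 / a), by positivity, ?_, ?_⟩
    · have hzn : (∑ i, ‖z i‖ ^ a) ^ (1 / a) ≤ (k : ℝ) ^ (1 / a) := by
        have hz2 := rpow_sum_le_card_rpow_mul Finset.univ (fun i => norm_nonneg (z i)) ha0
          (by linarith : a ≤ 2)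
        rw [Finset.card_univ, Fintype.card_fin] at hz2
        simp only [Real.rpow_two] at hz2
        have hsq : (∑ i, ‖z i‖ ^ 2) ^ ((1 : ℝ) / 2) ≤
            (k : ℝ) ^ ((1 : ℝ) / 2) * ((n : ℝ) ^ ((1 : ℝ) / 2) * (N : ℝ) ^ (-(1 : ℝ) / 2)) := by
          have e : (N : ℝ) ^ (-(1 : ℝ) / 2) = ((N : ℝ)⁻¹) ^ ((1 : ℝ) / 2) := by
            rw [Real.inv_rpow hN0.le, ← Real.rpow_neg hN0.le]; norm_num
          rw [e, ← Real.mul_rpow hn0.le (by positivity), ← Real.mul_rpow hk0.le (by positivity)]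
          refine Real.rpow_le_rpow (by positivity) (hz.trans ?_) (by norm_num)
          rw [div_eq_mul_inv]
          gcongr
        have hξinv : (N : ℝ) ^ w * ((n : ℝ) ^ ((1 : ℝ) / 2) * (N : ℝ) ^ (-(1 : ℝ) / 2)) = ξ₀⁻¹ := by
          rw [hξ₀, mul_inv, ← Real.rpow_neg hN0.le, ← Real.rpow_neg hn0.le,
            mul_left_comm, ← Real.rpow_add hN0, mul_comm]
          congr 2 <;> [rw [hw]; skip] <;> ring
        calc _ ≤ (N : ℝ) ^ w * ((k : ℝ) ^ ((1 : ℝ) / 2) *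
              ((n : ℝ) ^ ((1 : ℝ) / 2) * (N : ℝ) ^ (-(1 : ℝ) / 2))) :=
              hz2.trans (mul_le_mul_of_nonneg_left hsq (by positivity))
          _ = (k : ℝ) ^ ((1 : ℝ) / 2) * ξ₀⁻¹ := by rw [← hξinv]; ring
          _ ≤ (k : ℝ) ^ ((1 : ℝ) / 2) * (k : ℝ) ^ w := by
              refine mul_le_mul_of_nonneg_left ?_ (by positivity)
              calc ξ₀⁻¹ ≤ ξ⁻¹ := inv_anti₀ hξ0 (min_le_right _ _)
                _ = κ ^ w := hκw.symm
                _ ≤ (k : ℝ) ^ w := Real.rpow_le_rpow (by positivity) hκk hw0.le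
          _ = (k : ℝ) ^ (1 / a) := by
              rw [← Real.rpow_add hk0]; congr 1; rw [hw]; ring
      have hind : (∑ i, |if i ∈ S then (1 : ℝ) else 0| ^ a) ^ (1 / a) = (k : ℝ) ^ (1 / a) := by
        have e : ∀ i, |if i ∈ S then (1 : ℝ) else 0| ^ a = if i ∈ S then (1 : ℝ) else 0 := by
          intro i; split_ifs <;> simp [ha0.ne']
        simp [e, hS]
      have hadd := Real.Lp_add_le Finset.univ (fun i => if i ∈ S then (1 : ℝ) else 0)
        (fun i => ‖z i‖) h1.le
      simp only [abs_norm] at hadd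
      rw [hind] at hadd
      refine le_trans (Real.rpow_le_rpow (by positivity) (Finset.sum_le_sum fun i _ => ?_)
        (by positivity)) (hadd.trans (by linarith))
      exact Real.rpow_le_rpow (norm_nonneg _) ((hxz i).trans (le_abs_self _)) ha0.le
    · have hhalf : (k : ℝ) / 2 ≤ ∑ i ∈ S, ‖x i‖ := by
        refine le_trans ?_ hxS
        have : (m : ℝ) / N ≤ 1 / 2 := by
          rw [div_le_div_iff₀ hN0 two_pos]
          have : (2 * m : ℝ) ≤ N := by exact_mod_cast hmN
          linarith
        nlinarith
      have hS1 := rpow_sum_le_card_rpow_mul S (fun i => norm_nonneg (x i)) one_pos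
        (by linarith : 1 ≤ b)
      simp only [Real.rpow_one, div_one, hS] at hS1
      have hSu : (∑ i ∈ S, ‖x i‖ ^ b) ^ (1 / b) ≤ (∑ i, ‖x i‖ ^ b) ^ (1 / b) :=
        Real.rpow_le_rpow (by positivity) (Finset.sum_le_sum_of_subset_of_nonneg
          (Finset.subset_univ S) fun i _ _ => by positivity) (by positivity)
      have hlow : (k : ℝ) ^ (1 / b) / 2 ≤ (∑ i, ‖x i‖ ^ b) ^ (1 / b) := by
        have h := hhalf.trans (hS1.trans (mul_le_mul_of_nonneg_left hSu (by positivity)))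
        have e : (k : ℝ) = (k : ℝ) ^ (1 - 1 / b) * (k : ℝ) ^ (1 / b) := by
          rw [← Real.rpow_add hk0]; simp
        have hkp : 0 < (k : ℝ) ^ (1 - 1 / b) := by positivity
        refine le_of_mul_le_mul_left ?_ hkp
        calc _ = (k : ℝ) / 2 := by rw [mul_div_assoc', ← e]
          _ ≤ _ := h
      have hkδ : ξ ^ (δ / w) * (k : ℝ) ^ δ ≤ 2 := by
        calc ξ ^ (δ / w) * (k : ℝ) ^ δ ≤ ξ ^ (δ / w) * (2 * κ) ^ δ := by gcongr
          _ = 2 ^ δ * (κ ^ δ * ξ ^ (δ / w)) := by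
              rw [Real.mul_rpow (by norm_num) (by positivity)]; ring
          _ = 2 ^ δ := by rw [hκδ, mul_one]
          _ ≤ 2 ^ (1 : ℝ) := Real.rpow_le_rpow_of_exponent_le (by norm_num) hδ1
          _ = 2 := Real.rpow_one 2
      have hka : (k : ℝ) ^ (1 / a) = (k : ℝ) ^ δ * (k : ℝ) ^ (1 / b) := by
        rw [← Real.rpow_add hk0]; congr 1; rw [hδ]; ring
      refine le_trans ?_ hlow
      rw [hka]
      have hkb : 0 < (k : ℝ) ^ (1 / b) := by positivity
      nlinarith [mul_le_mul_of_nonneg_right hkδ hkb.le]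
  · -- The codimension is comparable with the dimension.
    have hMbot : M ≠ ⊥ := by
      intro h
      have h3 := M.finrank_quotient_add_finrank
      rw [h, finrank_bot, Module.finrank_fin_fun, ← h, ← hm] at h3
      omega
    obtain ⟨x, hxM, hx0⟩ := Submodule.exists_mem_ne_zero_of_ne_bot hMbot
    obtain ⟨i, hi⟩ := Function.ne_iff.1 hx0
    have hpos : 0 < ∑ i, ‖x i‖ ^ a :=
      Finset.sum_pos' (fun i _ => by positivity)
        ⟨i, Finset.mem_univ i, Real.rpow_pos_of_pos (norm_pos_iff.2 hi) _⟩
    refine ⟨x, hxM, _, Real.rpow_pos_of_pos hpos _, le_rfl, ?_⟩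
    have hcard := rpow_sum_le_card_rpow_mul Finset.univ (fun i => norm_nonneg (x i)) ha0 h12.le
    rw [Finset.card_univ, Fintype.card_fin, ← hδ] at hcard
    have hξle : ξ ≤ 2 * (N : ℝ) ^ (-w) := by
      refine (min_le_right _ _).trans ?_
      rw [← hNw, hξ₀, mul_left_comm]
      refine mul_le_mul_of_nonneg_left ?_ (by positivity)
      have hN2 : (N : ℝ) / 4 ≤ n := by
        have : (N : ℝ) < 2 * m := by exact_mod_cast hmN
        linarith
      refine (Real.rpow_le_rpow_of_nonpos (by positivity) hN2 (by norm_num)).trans_eq ?_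
      rw [div_eq_mul_inv, Real.mul_rpow hN0.le (by norm_num), mul_comm]
      congr 1
      rw [show (4 : ℝ)⁻¹ = (2 : ℝ) ^ (-2 : ℝ) by rw [Real.rpow_neg (by norm_num)]; norm_num,
        ← Real.rpow_mul (by norm_num)]
      norm_num
    have hξθ : ξ ^ (δ / w) ≤ 2 * (N : ℝ) ^ (-δ) := by
      calc ξ ^ (δ / w) ≤ (2 * (N : ℝ) ^ (-w)) ^ (δ / w) :=
            Real.rpow_le_rpow hξ0.le hξle (by positivity)
        _ = 2 ^ (δ / w) * (N : ℝ) ^ (-δ) := by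
            rw [Real.mul_rpow (by norm_num) (by positivity), ← Real.rpow_mul hN0.le]
            congr 2; field_simp
        _ ≤ 2 * (N : ℝ) ^ (-δ) := by
            gcongr
            calc (2 : ℝ) ^ (δ / w) ≤ 2 ^ (1 : ℝ) :=
                  Real.rpow_le_rpow_of_exponent_le (by norm_num) ((div_le_one hw0).2 hδw)
              _ = 2 := Real.rpow_one 2
    have hNδ : (N : ℝ) ^ (-δ) * (N : ℝ) ^ δ = 1 := by
      rw [← Real.rpow_add hN0]; simp
    have hT : 0 ≤ (∑ i, ‖x i‖ ^ b) ^ (1 / b) := by positivity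
    have hNδ0 : 0 < (N : ℝ) ^ (-δ) := by positivity
    calc 1 / 8 * ξ ^ (δ / w) * (∑ i, ‖x i‖ ^ a) ^ (1 / a)
        ≤ 1 / 8 * (2 * (N : ℝ) ^ (-δ)) * ((N : ℝ) ^ δ * (∑ i, ‖x i‖ ^ b) ^ (1 / b)) := by
          gcongr
      _ = 1 / 4 * ((N : ℝ) ^ (-δ) * (N : ℝ) ^ δ) * (∑ i, ‖x i‖ ^ b) ^ (1 / b) := by ring
      _ ≤ _ := by rw [hNδ]; linarith

end LowerBound

/-- Let `1 < p1 < p2 ≤ 2` and `θ1 = (1/p1 - 1/p2)/(1/p1 - 1/2)`. There is a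
constant `c > 0`, depending only on `p1, p2`, such that for all `N` and all `n ≤ N`,
`c⁻¹ ξ^{θ1} ≤ c_n(id : ℓ_{p1}^N → ℓ_{p2}^N) ≤ c ξ^{θ1}`, where
`ξ = min{1, N^{1-1/p1} n^{-1/2}}`. -/
theorem gelfand_id_lp_small (p1 p2 : ℝ≥0∞) (hp1 : 1 < p1) (hp12 : p1 < p2) (hp2 : p2 ≤ 2) :
    ∃ c : ℝ, 0 < c ∧ ∀ N n : ℕ, 1 ≤ n → n ≤ N →
      c⁻¹ * min 1 ((N : ℝ) ^ (1 - 1 / p1.toReal) * (n : ℝ) ^ (-(1 : ℝ) / 2)) ^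
          ((1 / p1.toReal - 1 / p2.toReal) / (1 / p1.toReal - 1 / 2)) ≤
        gelfandLp p1 p2 N n ∧
      gelfandLp p1 p2 N n ≤
        c * min 1 ((N : ℝ) ^ (1 - 1 / p1.toReal) * (n : ℝ) ^ (-(1 : ℝ) / 2)) ^
          ((1 / p1.toReal - 1 / p2.toReal) / (1 / p1.toReal - 1 / 2)) := by
  obtain ⟨C, hC, hupper⟩ := exists_gelfandLp_le hp1 hp12 hp2
  refine ⟨C + 8, by positivity, fun N n hn hnN => ⟨?_, ?_⟩⟩
  · refine le_trans (mul_le_mul_of_nonneg_right ?_ (by positivity))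
      (min_rpow_le_gelfandLp hp1 hp12 hp2 hn hnN)
    rw [inv_eq_one_div]
    exact one_div_le_one_div_of_le (by norm_num) (by linarith)
  · refine (hupper N n hn hnN).trans (mul_le_mul_of_nonneg_right (by linarith) (by positivity))
end

section
/- Let 1 ≤ p2 < p1 ≤ ∞ and let n, N ∈ ℕ with n ≤ N. Then the n-th Gelfand number of the identity map satisfies the exact equality c_n(id : ℓ_{p1}^N → ℓ_{p2}^N) = (N − n + 1)^{1/p2 − 1/p1}. -/
open scoped ENNReal Classical

/-- Hölder's inequality on the support: a vector of `ℓ_p` norm at most one which vanishes off `s`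
has `ℓ_q` norm at most `s.card ^ (1 / q - 1 / p)`. -/
theorem lpNorm_le_card_rpow {p q : ℝ≥0∞} (hq : 1 ≤ q) (hqp : q < p) {N : ℕ} (s : Finset (Fin N))
    (x : Fin N → ℂ) (hs : ∀ i, i ∉ s → x i = 0) (hx : lpNorm p x ≤ 1) :
    lpNorm q x ≤ (s.card : ℝ) ^ (1 / q.toReal - 1 / p.toReal) := by
  have hqt : q ≠ ∞ := hqp.ne_top
  have hb : 1 ≤ q.toReal := by
    simpa using ENNReal.toReal_mono hqt hq
  have hb0 : 0 < q.toReal := by linarith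
  have hsum : ∀ r : ℝ, 0 < r → ∑ i, ‖x i‖ ^ r = ∑ i ∈ s, ‖x i‖ ^ r := by
    intro r hr
    refine (Finset.sum_subset (Finset.subset_univ s) fun i _ hi => ?_).symm
    rw [hs i hi, norm_zero, Real.zero_rpow hr.ne']
  have hS2 : 0 ≤ ∑ i ∈ s, ‖x i‖ ^ q.toReal := by positivity
  rw [lpNorm, if_neg hqt, hsum _ hb0]
  by_cases hp : p = ∞
  · rw [lpNorm, if_pos hp] at hx
    simp only [hp, ENNReal.toReal_top, div_zero, sub_zero]
    refine Real.rpow_le_rpow hS2 ?_ (by positivity)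
    have hle : ∀ i ∈ s, ‖x i‖ ^ q.toReal ≤ 1 := fun i _ =>
      Real.rpow_le_one (norm_nonneg _)
        ((le_ciSup (f := fun i => ‖x i‖) (Set.finite_range _).bddAbove i).trans hx) hb0.le
    simpa using Finset.sum_le_card_nsmul s _ 1 hle
  · have hab : q.toReal < p.toReal := (ENNReal.toReal_lt_toReal hqt hp).2 hqp
    have ha0 : 0 < p.toReal := hb0.trans hab
    rw [lpNorm, if_neg hp, hsum _ ha0] at hx
    have hS1 : 0 ≤ ∑ i ∈ s, ‖x i‖ ^ p.toReal := by positivity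
    have hS1' : ∑ i ∈ s, ‖x i‖ ^ p.toReal ≤ 1 := by
      by_contra! h
      exact absurd hx (not_le.2 (Real.one_lt_rpow h (by positivity)))
    have key := Real.rpow_sum_le_const_mul_sum_rpow s (fun i => ‖x i‖ ^ q.toReal)
      (p := p.toReal / q.toReal) ((one_le_div hb0).2 hab.le)
    have hpow : ∀ i, |‖x i‖ ^ q.toReal| ^ (p.toReal / q.toReal) = ‖x i‖ ^ p.toReal := fun i => by
      rw [abs_of_nonneg (by positivity), ← Real.rpow_mul (norm_nonneg _),
        mul_div_cancel₀ _ hb0.ne']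
    have habs : ∀ i, |‖x i‖ ^ q.toReal| = ‖x i‖ ^ q.toReal := fun i =>
      abs_of_nonneg (by positivity)
    simp only [hpow] at key
    simp only [habs] at key
    have key' := key.trans (mul_le_of_le_one_right (by positivity) hS1')
    have := Real.rpow_le_rpow (by positivity) key' (one_div_nonneg.2 ha0.le)
    rw [← Real.rpow_mul hS2, ← Real.rpow_mul (by positivity)] at this
    convert this using 2 <;> field_simp

/-- The unit ball of the sup norm on a subspace contains a vector with at least as many
coordinates of modulus one as the dimension of the subspace. -/
theorem exists_mem_norm_le_one_finrank_le_card {N : ℕ} (M : Submodule ℂ (Fin N → ℂ)) :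
    ∃ x ∈ M, (∀ i, ‖x i‖ ≤ 1) ∧
      Module.finrank ℂ M ≤ (Finset.univ.filter fun i => ‖x i‖ = 1).card := by
  have hcomp : IsCompact ((M : Set (Fin N → ℂ)) ∩ Metric.closedBall 0 1) :=
    (isCompact_closedBall 0 1).inter_left M.closed_of_finiteDimensional
  obtain ⟨x, hx⟩ := hcomp.extremePoints_nonempty ⟨0, by simp⟩
  have hxM : x ∈ M := hx.1.1
  have hxle : ∀ i, ‖x i‖ ≤ 1 := fun i =>
    (norm_le_pi_norm x i).trans (mem_closedBall_zero_iff.1 hx.1.2)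
  refine ⟨x, hxM, hxle, ?_⟩
  by_contra! hlt
  set A := Finset.univ.filter fun i => ‖x i‖ = 1 with hA
  let R : M →ₗ[ℂ] (A → ℂ) := (LinearMap.funLeft ℂ ℂ (fun i : A => (i : Fin N))) ∘ₗ M.subtype
  have hker : LinearMap.ker R ≠ ⊥ := LinearMap.ker_ne_bot_of_finrank_lt (by simpa using hlt)
  obtain ⟨y, hyR, hy0⟩ := (Submodule.ne_bot_iff _).1 hker
  have hyA : ∀ i, ‖x i‖ = 1 → (y : Fin N → ℂ) i = 0 := fun i hi =>
    congrFun (LinearMap.mem_ker.1 hyR) ⟨i, by simpa [hA] using hi⟩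
  have hev : ∀ᶠ t : ℝ in nhds 0, ∀ i, ‖x i + t • (y : Fin N → ℂ) i‖ ≤ 1 ∧
      ‖x i - t • (y : Fin N → ℂ) i‖ ≤ 1 := by
    refine Filter.eventually_all.2 fun i => ?_
    rcases (hxle i).eq_or_lt with hi | hi
    · simp [hyA i hi, hxle i]
    · have h1 : Continuous fun t : ℝ => ‖x i + t • (y : Fin N → ℂ) i‖ := by fun_prop
      have h2 : Continuous fun t : ℝ => ‖x i - t • (y : Fin N → ℂ) i‖ := by fun_prop
      filter_upwards [h1.continuousAt.eventually_lt continuousAt_const (by simpa using hi),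
        h2.continuousAt.eventually_lt continuousAt_const (by simpa using hi)] with t h3 h4
      exact ⟨h3.le, h4.le⟩
  obtain ⟨t, ht, ht0⟩ := ((hev.filter_mono nhdsWithin_le_nhds).and
    (self_mem_nhdsWithin : {(0 : ℝ)}ᶜ ∈ nhdsWithin 0 {(0 : ℝ)}ᶜ)).exists
  have hty : t • (y : Fin N → ℂ) ∈ M := by
    have : t • (y : Fin N → ℂ) = (t : ℂ) • (y : Fin N → ℂ) := by
      ext i; simp
    rw [this]
    exact M.smul_mem _ y.2
  have hplus : x + t • (y : Fin N → ℂ) ∈ (M : Set (Fin N → ℂ)) ∩ Metric.closedBall 0 1 :=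
    ⟨M.add_mem hxM hty, mem_closedBall_zero_iff.2
      ((pi_norm_le_iff_of_nonneg zero_le_one).2 fun i => (ht i).1)⟩
  have hminus : x - t • (y : Fin N → ℂ) ∈ (M : Set (Fin N → ℂ)) ∩ Metric.closedBall 0 1 :=
    ⟨M.sub_mem hxM hty, mem_closedBall_zero_iff.2
      ((pi_norm_le_iff_of_nonneg zero_le_one).2 fun i => (ht i).2)⟩
  have hseg : x ∈ openSegment ℝ (x + t • (y : Fin N → ℂ)) (x - t • (y : Fin N → ℂ)) :=
    ⟨1 / 2, 1 / 2, by norm_num, by norm_num, by norm_num, by module⟩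
  have heq : x + t • (y : Fin N → ℂ) = x := hx.2 hplus hminus hseg
  have hzero : t • (y : Fin N → ℂ) = 0 := by simpa using heq
  rcases smul_eq_zero.1 hzero with h | h
  · exact ht0 h
  · exact hy0 (Subtype.ext h)

theorem lpNorm_smul_of_nonneg {p : ℝ≥0∞} (hp0 : p.toReal ≠ 0) (hp : p ≠ ∞) {N : ℕ} {c : ℝ}
    (hc : 0 ≤ c) (x : Fin N → ℂ) : lpNorm p ((c : ℂ) • x) = c * lpNorm p x := by
  have : ∀ i, ‖((c : ℂ) • x) i‖ ^ p.toReal = c ^ p.toReal * ‖x i‖ ^ p.toReal := fun i => by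
    rw [Pi.smul_apply, norm_smul, Complex.norm_real, Real.norm_of_nonneg hc,
      Real.mul_rpow hc (norm_nonneg _)]
  simp only [lpNorm, if_neg hp, this]
  rw [← Finset.mul_sum, Real.mul_rpow (by positivity) (by positivity), one_div,
    Real.rpow_rpow_inv hc hp0]

/-- A subspace of positive dimension at least `m` contains a vector of `ℓ_p` norm at most one and
`ℓ_q` norm at least `m ^ (1 / q - 1 / p)`. -/
theorem exists_mem_lpNorm_le_one_rpow_le {p q : ℝ≥0∞} (hq : 1 ≤ q) (hqp : q < p) {N m : ℕ}
    (hm : 0 < m) (M : Submodule ℂ (Fin N → ℂ)) (hM : m ≤ Module.finrank ℂ M) :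
    ∃ x ∈ M, lpNorm p x ≤ 1 ∧ (m : ℝ) ^ (1 / q.toReal - 1 / p.toReal) ≤ lpNorm q x := by
  have hqt : q ≠ ∞ := hqp.ne_top
  have hb : 1 ≤ q.toReal := by
    simpa using ENNReal.toReal_mono hqt hq
  have hb0 : 0 < q.toReal := by linarith
  obtain ⟨z, hzM, hz1, hcard⟩ := exists_mem_norm_le_one_finrank_le_card M
  have hsum : ∀ r : ℝ, (m : ℝ) ≤ ∑ i, ‖z i‖ ^ r := fun r => by
    calc (m : ℝ) ≤ ((Finset.univ.filter fun i => ‖z i‖ = 1).card : ℝ) := by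
          exact_mod_cast hM.trans hcard
      _ = ∑ i ∈ Finset.univ.filter (fun i => ‖z i‖ = 1), ‖z i‖ ^ r := by
          rw [Finset.sum_congr rfl (g := fun _ => (1 : ℝ))]
          · simp
          · intro i hi
            rw [(Finset.mem_filter.1 hi).2, Real.one_rpow]
      _ ≤ _ := Finset.sum_le_sum_of_subset_of_nonneg (Finset.subset_univ _)
          fun i _ _ => by positivity
  have hm' : (0 : ℝ) < m := by exact_mod_cast hm
  by_cases hp : p = ∞
  · refine ⟨z, hzM, ?_, ?_⟩
    · rw [lpNorm, if_pos hp]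
      exact Real.iSup_le hz1 zero_le_one
    · rw [lpNorm, if_neg hqt, hp, ENNReal.toReal_top, div_zero, sub_zero]
      exact Real.rpow_le_rpow hm'.le (hsum _) (by positivity)
  · have hab : q.toReal < p.toReal := (ENNReal.toReal_lt_toReal hqt hp).2 hqp
    have ha0 : 0 < p.toReal := hb0.trans hab
    have hS1 : 0 < ∑ i, ‖z i‖ ^ p.toReal := hm'.trans_le (hsum _)
    have hc : 0 < lpNorm p z := by
      rw [lpNorm, if_neg hp]
      positivity
    refine ⟨((lpNorm p z)⁻¹ : ℝ) • z, ?_, ?_, ?_⟩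
    · have : (((lpNorm p z)⁻¹ : ℝ) • z) = (((lpNorm p z)⁻¹ : ℝ) : ℂ) • z := by
        ext i; simp
      rw [this]
      exact M.smul_mem _ hzM
    · change lpNorm p ((((lpNorm p z)⁻¹ : ℝ) : ℂ) • z) ≤ 1
      rw [lpNorm_smul_of_nonneg ha0.ne' hp (by positivity), inv_mul_cancel₀ hc.ne']
    · change _ ≤ lpNorm q ((((lpNorm p z)⁻¹ : ℝ) : ℂ) • z)
      rw [lpNorm_smul_of_nonneg hb0.ne' hqt (by positivity), inv_mul_eq_div]
      simp only [lpNorm, if_neg hp, if_neg hqt]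
      have hexp : 0 ≤ 1 / q.toReal - 1 / p.toReal :=
        sub_nonneg.2 (one_div_le_one_div_of_le hb0 hab.le)
      calc (m : ℝ) ^ (1 / q.toReal - 1 / p.toReal)
          ≤ (∑ i, ‖z i‖ ^ p.toReal) ^ (1 / q.toReal - 1 / p.toReal) :=
            Real.rpow_le_rpow hm'.le (hsum _) hexp
        _ = (∑ i, ‖z i‖ ^ p.toReal) ^ (1 / q.toReal) /
              (∑ i, ‖z i‖ ^ p.toReal) ^ (1 / p.toReal) := Real.rpow_sub hS1 _ _
        _ ≤ _ := by
            refine div_le_div_of_nonneg_right (Real.rpow_le_rpow hS1.le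
              (Finset.sum_le_sum fun i _ => ?_) (by positivity)) (by positivity)
            exact Real.rpow_le_rpow_of_exponent_ge' (norm_nonneg _) (hz1 i) hb0.le hab.le

/-- The vectors vanishing off `s` form a subspace of codimension at most `sᶜ.card`. -/
theorem exists_submodule_vanishing_off {N : ℕ} (s : Finset (Fin N)) :
    ∃ M : Submodule ℂ (Fin N → ℂ), Module.finrank ℂ ((Fin N → ℂ) ⧸ M) ≤ sᶜ.card ∧
      ∀ x ∈ M, ∀ i, i ∉ s → x i = 0 := by
  let R : (Fin N → ℂ) →ₗ[ℂ] ((sᶜ : Finset (Fin N)) → ℂ) :=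
    LinearMap.funLeft ℂ ℂ (fun i : (sᶜ : Finset (Fin N)) => (i : Fin N))
  refine ⟨LinearMap.ker R, ?_, fun x hx i hi =>
    congrFun (LinearMap.mem_ker.1 hx) ⟨i, Finset.mem_compl.2 hi⟩⟩
  rw [R.quotKerEquivRange.finrank_eq]
  refine (Submodule.finrank_le _).trans_eq ?_
  rw [Module.finrank_fintype_fun_eq_card, Fintype.card_coe]

/-- Let `1 ≤ p2 < p1 ≤ ∞` and `n ≤ N`. Then
`c_n(id : ℓ_{p1}^N → ℓ_{p2}^N) = (N - n + 1)^{1/p2 - 1/p1}` (with `1/∞` read as `0`). -/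
theorem gelfand_id_lp_decreasing (p1 p2 : ℝ≥0∞) (hp2 : 1 ≤ p2) (hp21 : p2 < p1)
    (n N : ℕ) (hn : 1 ≤ n) (hnN : n ≤ N) :
    gelfandLp p1 p2 N n = ((N : ℝ) - (n : ℝ) + 1) ^ (1 / p2.toReal - 1 / p1.toReal) := by
  have hcast : ((N : ℝ) - (n : ℝ) + 1) = ((N - n + 1 : ℕ) : ℝ) := by
    push_cast [Nat.cast_sub hnN]
    ring
  rw [hcast]
  have hlower : ∀ M : Submodule ℂ (Fin N → ℂ), Module.finrank ℂ ((Fin N → ℂ) ⧸ M) < n →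
      ((N - n + 1 : ℕ) : ℝ) ^ (1 / p2.toReal - 1 / p1.toReal) ≤
        sSup { t : ℝ | ∃ x ∈ M, lpNorm p1 x ≤ 1 ∧ t = lpNorm p2 x } := by
    intro M hM
    have hdim := M.finrank_quotient_add_finrank
    rw [Module.finrank_fin_fun] at hdim
    obtain ⟨x, hxM, hx1, hx2⟩ := exists_mem_lpNorm_le_one_rpow_le hp2 hp21
      (Nat.succ_pos (N - n)) M (by omega)
    refine hx2.trans (le_csSup
      ⟨((Finset.univ : Finset (Fin N)).card : ℝ) ^ (1 / p2.toReal - 1 / p1.toReal), ?_⟩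
      ⟨x, hxM, hx1, rfl⟩)
    rintro _ ⟨y, -, hy, rfl⟩
    exact lpNorm_le_card_rpow hp2 hp21 Finset.univ y (by simp) hy
  rw [gelfandLp]
  apply le_antisymm
  · obtain ⟨s, hs⟩ : ∃ s : Finset (Fin N), s.card = N - n + 1 := by
      obtain ⟨s, -, hs⟩ := Finset.exists_subset_card_eq
        (s := (Finset.univ : Finset (Fin N))) (n := N - n + 1) (by simp; omega)
      exact ⟨s, hs⟩
    obtain ⟨M, hM, hMs⟩ := exists_submodule_vanishing_off s
    have hMn : Module.finrank ℂ ((Fin N → ℂ) ⧸ M) < n := by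
      rw [Finset.card_compl, Fintype.card_fin] at hM
      omega
    refine le_trans (csInf_le ⟨((N - n + 1 : ℕ) : ℝ) ^ (1 / p2.toReal - 1 / p1.toReal), ?_⟩
      ⟨M, hMn, rfl⟩) (Real.sSup_le ?_ (by positivity))
    · rintro _ ⟨M', hM', rfl⟩
      exact hlower M' hM'
    · rintro _ ⟨x, hxM, hx, rfl⟩
      rw [← hs]
      exact lpNorm_le_card_rpow hp2 hp21 s x (hMs x hxM) hx
  · refine le_csInf ⟨_, ⊤, ?_, rfl⟩ ?_
    · have hdim := (⊤ : Submodule ℂ (Fin N → ℂ)).finrank_quotient_add_finrank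
      rw [finrank_top] at hdim
      omega
    · rintro _ ⟨M, hM, rfl⟩
      exact hlower M hM
end
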